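/- For every natural number n ≥ 3, there exists an element S of the integral symplectic group Sp(2n, ℤ) of order exactly 6 such that Sp(2n, ℤ) is generated by the set of all conjugates of S. -/

import Mathlib

namespace SpGen

open Matrix

/-- The underlying lattice. -/
abbrev V (n : ℕ) := (Fin n ⊕ Fin n) → ℤ

/-- The integral symplectic group. -/
abbrev G (n : ℕ) := Matrix.symplecticGroup (Fin n) ℤ

variable {n : ℕ}

/-- The symplectic form. -/
def om (x y : V n) : ℤ := x ⬝ᵥ (Matrix.J (Fin n) ℤ *ᵥ y)

lemma om_add_left (x y z : V n) : om (x + y) z = om x z + om y z := by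
  simp [om, add_dotProduct]
lemma om_add_right (x y z : V n) : om x (y + z) = om x y + om x z := by
  simp [om, mulVec_add, dotProduct_add]
lemma om_smul_left (k : ℤ) (x y : V n) : om (k • x) y = k * om x y := by
  simp only [om, smul_dotProduct, smul_eq_mul]
lemma om_smul_right (k : ℤ) (x y : V n) : om x (k • y) = k * om x y := by
  simp only [om, mulVec_smul, dotProduct_smul, smul_eq_mul]
lemma om_neg_left (x y : V n) : om (-x) y = - om x y := by
  simp [om]
lemma om_neg_right (x y : V n) : om x (-y) = - om x y := by
  simp [om, mulVec_neg]
lemma om_sub_left (x y z : V n) : om (x - y) z = om x z - om y z := by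
  simp [om, sub_dotProduct]
lemma om_sub_right (x y z : V n) : om x (y - z) = om x y - om x z := by
  simp [om, mulVec_sub, dotProduct_sub]
lemma om_swap (x y : V n) : om y x = - om x y := by
  unfold om
  rw [dotProduct_comm, ← vecMul_transpose, Matrix.J_transpose, vecMul_neg, neg_dotProduct,
    ← dotProduct_mulVec]
lemma om_self (x : V n) : om x x = 0 := by
  have := om_swap x x
  omega

lemma mem_of_om (A : Matrix (Fin n ⊕ Fin n) (Fin n ⊕ Fin n) ℤ)
    (h : ∀ x y : V n, om (A *ᵥ x) (A *ᵥ y) = om x y) : A ∈ Matrix.symplecticGroup (Fin n) ℤ := by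
  rw [SymplecticGroup.mem_iff']
  apply Matrix.ext_of_mulVec_single
  intro j
  apply dotProduct_eq
  intro u
  have := h u (Pi.single j 1)
  unfold om at this
  rw [dotProduct_comm, dotProduct_comm _ u, ← this, ← mulVec_mulVec, ← mulVec_mulVec,
    dotProduct_mulVec, vecMul_transpose]

/-- Action on vectors. -/
def act (g : G n) (x : V n) : V n := (g : Matrix _ _ ℤ) *ᵥ x

lemma act_mul (g h : G n) (x : V n) : act (g * h) x = act g (act h x) := by
  simp [act]
lemma act_one (x : V n) : act 1 x = x := by
  simp [act]
lemma act_add (g : G n) (x y : V n) : act g (x + y) = act g x + act g y := by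
  simp [act, mulVec_add]
lemma act_neg (g : G n) (x : V n) : act g (-x) = - act g x := by
  simp [act, mulVec_neg]
lemma act_smul (g : G n) (k : ℤ) (x : V n) : act g (k • x) = k • act g x := by
  simp only [act, mulVec_smul]
lemma act_inv_act (g : G n) (x : V n) : act g⁻¹ (act g x) = x := by
  rw [← act_mul, inv_mul_cancel, act_one]
lemma act_act_inv (g : G n) (x : V n) : act g (act g⁻¹ x) = x := by
  rw [← act_mul, mul_inv_cancel, act_one]

lemma om_act (g : G n) (x y : V n) : om (act g x) (act g y) = om x y := by
  have := SymplecticGroup.mem_iff'.1 g.2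
  unfold om act
  rw [← vecMul_transpose, ← dotProduct_mulVec, mulVec_mulVec, mulVec_mulVec, this]

/-- Standard basis. -/
def E (a : Fin n ⊕ Fin n) : V n := Pi.single a 1

lemma ext_E {g h : G n} (H : ∀ a, act g (E a) = act h (E a)) : g = h := by
  apply Subtype.ext
  apply Matrix.ext_of_mulVec_single
  exact H

lemma ext_act {g h : G n} (H : ∀ x, act g x = act h x) : g = h := ext_E fun _ => H _

lemma Tmat_mulVec (k : ℤ) (z x : V n) :
    (1 + k • vecMulVec z (Matrix.J (Fin n) ℤ *ᵥ z)) *ᵥ x = x + (k * om x z) • z := by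
  rw [add_mulVec, one_mulVec, smul_mulVec, vecMulVec_mulVec]
  ext i
  simp [om, dotProduct_comm]
  ring

/-- Transvections. -/
def T (k : ℤ) (z : V n) : G n :=
  ⟨1 + k • vecMulVec z (Matrix.J (Fin n) ℤ *ᵥ z), by
    apply mem_of_om
    intro x y
    rw [Tmat_mulVec, Tmat_mulVec]
    simp only [om_add_left, om_add_right, om_smul_left, om_smul_right, om_self]
    rw [om_swap y z]
    ring⟩

lemma act_T (k : ℤ) (z x : V n) : act (T k z) x = x + (k * om x z) • z := Tmat_mulVec k z x

lemma T_neg (k : ℤ) (z : V n) : T k (-z) = T k z := by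
  apply ext_act
  intro x
  simp [act_T, om_neg_right]

lemma T_mul (k l : ℤ) (z : V n) : T k z * T l z = T (k + l) z := by
  apply ext_act
  intro x
  simp only [act_mul, act_T, om_add_left, om_smul_left, om_self]
  module

lemma T_zero (z : V n) : T 0 z = 1 := by
  apply ext_act
  intro x
  simp [act_T, act_one]

lemma T_inv (k : ℤ) (z : V n) : (T k z)⁻¹ = T (-k) z := by
  rw [inv_eq_iff_mul_eq_one, T_mul, add_neg_cancel, T_zero]

lemma T_conj (g : G n) (k : ℤ) (z : V n) : g * T k z * g⁻¹ = T k (act g z) := by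
  apply ext_act
  intro x
  simp only [act_mul, act_T, act_add, act_smul, act_act_inv]
  rw [← om_act g (act g⁻¹ x) z, act_act_inv]

lemma T_mem (N : Subgroup (G n)) (z : V n) (h : T 1 z ∈ N) (k : ℤ) : T k z ∈ N := by
  have key : T 1 z ^ k = T k z := by
    induction k using Int.induction_on with
    | zero => simp [T_zero]
    | succ i ih => rw [_root_.zpow_add, ih, zpow_one, T_mul]
    | pred i ih => rw [_root_.zpow_sub, ih, zpow_one, T_inv, T_mul]; rfl
  rw [← key]
  exact N.zpow_mem h k

/-- The move between vectors pairing to one. -/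
lemma T_move (x y : V n) (h : om x y = 1) : act (T 1 (y - x)) x = y := by
  rw [act_T, om_sub_right, om_self, h]
  simp

lemma moveA (a b c : V n) (hab : om a b = 1) (hac : om a c = 1) :
    act (T 1 (c - (b - (om b c - 1) • a)) * T (om b c - 1) a) b = c ∧
    act (T 1 (c - (b - (om b c - 1) • a)) * T (om b c - 1) a) a = a := by
  constructor
  · rw [act_mul, act_T _ a b, om_swap a b, hab]
    have : b + ((om b c - 1) * -1) • a = b - (om b c - 1) • a := by module
    rw [this]
    apply T_move
    rw [om_sub_left, om_smul_left, hac]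
    ring
  · rw [act_mul, act_T _ a a, om_self, act_T]
    simp only [om_sub_right, om_smul_right, hab, hac, om_self, om_add_left, om_smul_left]
    module

section stage1

variable (N : Subgroup (G n)) [N.Normal]

lemma good_step (a b c : V n) (hab : om a b = 1) (hac : om a c = 1)
    (h : T 1 a * T 1 b ∈ N) : T 1 a * T 1 c ∈ N := by
  obtain ⟨h1, h2⟩ := moveA a b c hab hac
  generalize T 1 (c - (b - (om b c - 1) • a)) * T (om b c - 1) a = g at h1 h2
  have := Subgroup.Normal.conj_mem ‹N.Normal› _ h g
  have e : g * (T 1 a * T 1 b) * g⁻¹ = (g * T 1 a * g⁻¹) * (g * T 1 b * g⁻¹) := by group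
  rwa [e, T_conj, T_conj, h1, h2] at this

/-- All pairs starting at `a` are in `N`. -/
def Good (a : V n) : Prop := ∀ b, om a b = 1 → T 1 a * T 1 b ∈ N

lemma Good.next {a b : V n} (h : Good N a) (hab : om a b = 1) : Good N b := by
  intro c hc
  have h1 := h b hab
  have h2 : T 1 b * T 1 (-a) ∈ N := by
    rw [T_neg]
    exact Subgroup.Normal.mem_comm ‹N.Normal› h1
  exact good_step N b (-a) c (by rw [om_neg_right, om_swap a b, hab]; rfl) hc h2

lemma lantern (u v w : V n) (h1 : om u v = 0) (h2 : om u w = 0) (h3 : om v w = 0) :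
    T 1 (u + v + w) * T 1 u * T 1 v * T 1 w = T 1 (u + v) * T 1 (u + w) * T 1 (v + w) := by
  apply ext_act
  intro x
  have h1' := om_swap u v
  have h2' := om_swap u w
  have h3' := om_swap v w
  simp only [act_mul, act_T, om_add_left, om_add_right, om_smul_left, om_self, h1, h2, h3, h1', h2',
    h3']
  module

lemma stage1 (e0 e1 e2 f0 f1 f2 : V n)
    (e01 : om e0 e1 = 0) (e02 : om e0 e2 = 0) (e12 : om e1 e2 = 0)
    (h00 : om e0 f0 = 1) (h01 : om e0 f1 = 0) (h02 : om e0 f2 = 0)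
    (h10 : om e1 f0 = 0) (h11 : om e1 f1 = 1) (h12 : om e1 f2 = 0)
    (h20 : om e2 f0 = 0) (h21 : om e2 f1 = 0) (h22 : om e2 f2 = 1)
    (h : T 1 e0 * T 1 f0 ∈ N) : T 1 e0 ∈ N := by
  have g0 : Good N e0 := fun c hc => good_step N e0 f0 c h00 hc h
  have gf0 : Good N f0 := g0.next N h00
  have ge01 : Good N (-(e0 + e1)) := gf0.next N (by
    rw [om_neg_right, om_swap (e0 + e1) f0, om_add_left]; omega)
  have gf1 : Good N (-f1) := ge01.next N (by
    rw [om_neg_right, om_neg_left, om_add_left]; omega)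
  have ge02 : Good N (-(e0 + e2)) := gf0.next N (by
    rw [om_neg_right, om_swap (e0 + e2) f0, om_add_left]; omega)
  have gf2 : Good N (-f2) := ge02.next N (by
    rw [om_neg_right, om_neg_left, om_add_left]; omega)
  let p := QuotientGroup.mk' N
  have key : ∀ f z : V n, (Good N f ∨ Good N (-f)) → om z f = 1 → p (T 1 z) = (p (T 1 f))⁻¹ := by
    intro f z hf hz
    have : T 1 f * T 1 z ∈ N := by
      rcases hf with hf | hf
      · have := hf (-z) (by rw [om_neg_right, om_swap z f]; omega)
        rwa [T_neg] at this
      · have := hf z (by rw [om_neg_left, om_swap z f]; omega)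
        rwa [T_neg] at this
    have h2 : p (T 1 f * T 1 z) = 1 := (QuotientGroup.eq_one_iff _).2 this
    rw [map_mul] at h2
    exact eq_inv_of_mul_eq_one_right h2
  have a0 := key f0 e0 (Or.inl gf0) h00
  have a01 := key f0 (e0 + e1) (Or.inl gf0) (by rw [om_add_left]; omega)
  have a02 := key f0 (e0 + e2) (Or.inl gf0) (by rw [om_add_left]; omega)
  have a012 := key f0 (e0 + e1 + e2) (Or.inl gf0) (by rw [om_add_left, om_add_left]; omega)
  have b01 := key f1 (e0 + e1) (Or.inr gf1) (by rw [om_add_left]; omega)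
  have b1 := key f1 e1 (Or.inr gf1) h11
  have b12 := key f1 (e1 + e2) (Or.inr gf1) (by rw [om_add_left]; omega)
  have c02 := key f2 (e0 + e2) (Or.inr gf2) (by rw [om_add_left]; omega)
  have c2 := key f2 e2 (Or.inr gf2) h22
  have L := congrArg p (lantern e0 e1 e2 e01 e02 e12)
  simp only [map_mul] at L
  have b01' := b01.symm.trans a01
  have c02' := c02.symm.trans a02
  rw [a0, a01, a02, a012, b1, b12, c2, b01', c02'] at L
  have : p (T 1 e0) = 1 := by
    rw [a0]
    exact mul_eq_left.1 L
  exact (QuotientGroup.eq_one_iff _).1 this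

end stage1

/-- The sign of the pairing with a basis vector. -/
def sg : Fin n ⊕ Fin n → ℤ := Sum.elim (fun _ => 1) (fun _ => -1)

lemma om_E (x : V n) (a : Fin n ⊕ Fin n) : om x (E a) = sg a * x a.swap := by
  unfold om E
  rw [mulVec_single_one, dotProduct]
  rcases a with a | a <;> simp [Matrix.J, sg, Matrix.col, Matrix.one_apply, Fintype.sum_sum_type]

lemma sg_sq (a : Fin n ⊕ Fin n) : sg a * sg a = 1 := by
  rcases a with a | a <;> simp [sg]

lemma sg_swap (a : Fin n ⊕ Fin n) : sg a.swap = - sg a := by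
  rcases a with a | a <;> simp [sg]

lemma sg_cases (a : Fin n ⊕ Fin n) : sg a = 1 ∨ sg a = -1 := by
  rcases a with a | a <;> simp [sg]

lemma swap_ne (a : Fin n ⊕ Fin n) : a.swap ≠ a := by
  rcases a with a | a <;> simp

lemma E_same (a : Fin n ⊕ Fin n) : E a a = 1 := by simp [E]
lemma E_ne {a b : Fin n ⊕ Fin n} (h : b ≠ a) : E a b = 0 := by simp [E, h]

lemma om_EE (a : Fin n ⊕ Fin n) : om (E a) (E a.swap) = - sg a := by
  rw [om_E, Sum.swap_swap, E_same, sg_swap]; ring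

lemma om_EE_ne {a b : Fin n ⊕ Fin n} (h : b ≠ a.swap) : om (E a) (E b) = 0 := by
  rw [om_E, E_ne, mul_zero]
  rintro rfl
  simp at h

section stage2

variable (N : Subgroup (G n)) [N.Normal]

/-- Vectors whose transvections lie in `N`. -/
def Z (z : V n) : Prop := T 1 z ∈ N

lemma Z.neg {z : V n} (h : Z N z) : Z N (-z) := by
  unfold Z; rwa [T_neg]

lemma Z.next {z w : V n} (h : Z N z) (hw : om z w = 1 ∨ om z w = -1) : Z N w := by
  have key : ∀ w, om z w = 1 → Z N w := by
    intro w hw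
    have h1 := Subgroup.Normal.conj_mem ‹N.Normal› _ h (T 1 (w - z))
    rwa [T_conj, T_move z w hw] at h1
  rcases hw with hw | hw
  · exact key w hw
  · have := key (-w) (by rw [om_neg_right, hw]; rfl)
    have := Z.neg N this
    rwa [neg_neg] at this

lemma Z_E (a b : Fin n ⊕ Fin n) (h : Z N (E a)) : Z N (E b) := by
  by_cases hab : b = a
  · rwa [hab]
  have hs : b.swap ≠ a.swap := fun h => hab (by simpa using congrArg Sum.swap h)
  have h1 : Z N (E a.swap + E b.swap) := h.next N (by
    rw [om_add_right, om_EE, om_EE_ne hs]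
    rcases sg_cases a with h | h <;> simp [h])
  refine h1.next N ?_
  rw [om_add_left, om_EE_ne (a := a.swap) (by simpa using hab), om_E, E_same]
  rcases sg_cases b with h | h <;> simp [h]

/-- Elements of `N` fixing all vectors in `F`. -/
def K (F : Set (V n)) : Subgroup (G n) where
  carrier := {g | g ∈ N ∧ ∀ x ∈ F, act g x = x}
  mul_mem' := by
    rintro g h ⟨h1, h2⟩ ⟨h3, h4⟩
    refine ⟨N.mul_mem h1 h3, fun x hx => ?_⟩
    rw [act_mul, h4 x hx, h2 x hx]
  one_mem' := ⟨N.one_mem, fun x _ => act_one x⟩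
  inv_mem' := by
    rintro g ⟨h1, h2⟩
    refine ⟨N.inv_mem h1, fun x hx => ?_⟩
    conv_lhs => rw [← h2 x hx]
    exact act_inv_act g x

lemma T_mem_K {F : Set (V n)} {z : V n} (hz : Z N z) (hF : ∀ x ∈ F, om x z = 0) (k : ℤ) :
    T k z ∈ K N F := by
  refine ⟨T_mem N z hz k, fun x hx => ?_⟩
  rw [act_T, hF x hx]
  simp

/-- Symmetric short root element. -/
lemma short_act (u w x : V n) (k : ℤ) (h : om u w = 0) :
    act (T k (u + w) * T (-k) u * T (-k) w) x = x + k • (om x u • w + om x w • u) := by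
  have h' := om_swap u w
  simp only [act_mul, act_T, om_add_left, om_add_right, om_smul_left, om_self, h, h']
  module

lemma red (hZ : ∀ a, Z N (E a)) {F : Set (V n)} (a b : Fin n ⊕ Fin n) (hab : a ≠ b)
    (ha : ∀ x ∈ F, om x (E a) = 0) (hb : ∀ x ∈ F, om x (E b.swap) = 0)
    (x : V n) (h : b = a.swap ∨ x a.swap = 0) (k : ℤ) :
    ∃ g ∈ K N F, act g x = x + (k * x b) • E a := by
  by_cases hb' : b = a.swap
  · refine ⟨T (k * sg a) (E a), T_mem_K N (hZ a) ha _, ?_⟩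
    rw [act_T, om_E, ← hb']
    congr 2
    linear_combination k * x b * sg_sq a
  · have hx : x a.swap = 0 := h.resolve_left hb'
    have hne : b.swap ≠ a.swap := fun h => hab (by simpa using (congrArg Sum.swap h).symm)
    have ho : om (E a) (E b.swap) = 0 := om_EE_ne hne
    have hz : Z N (E a + E b.swap) := (hZ a.swap).next N (by
      rw [om_add_right, om_E, E_same, om_EE_ne (a := a.swap) (b := b.swap)]
      · rcases sg_cases a with h | h <;> simp [h]
      · intro h
        apply hb'
        simpa using congrArg Sum.swap h)
    refine ⟨T (k * sg b.swap) (E a + E b.swap) * T (-(k * sg b.swap)) (E a)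
      * T (-(k * sg b.swap)) (E b.swap), ?_, ?_⟩
    · refine mul_mem (mul_mem ?_ ?_) ?_
      · exact T_mem_K N hz (fun x hx => by rw [om_add_right, ha x hx, hb x hx]; rfl) _
      · exact T_mem_K N (hZ _) ha _
      · exact T_mem_K N (hZ _) hb _
    · rw [short_act _ _ _ _ ho, om_E, om_E, hx, Sum.swap_swap]
      have := sg_sq b.swap
      have e : k * x b = k * sg b.swap * (sg b.swap * x b) := by
        linear_combination -k * x b * this
      rw [e]
      module

/-- The l1 norm. -/
def nm (x : V n) : ℕ := ∑ a, (x a).natAbs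

lemma nm_lt (x : V n) (a : Fin n ⊕ Fin n) (t : ℤ) (h : (x a + t).natAbs < (x a).natAbs) :
    nm (x + t • E a) < nm x := by
  unfold nm
  apply Finset.sum_lt_sum
  · intro i _
    by_cases hi : i = a
    · subst hi; simp [E_same]; omega
    · simp [E_ne hi]
  · exact ⟨a, Finset.mem_univ _, by simpa [E_same] using h⟩

lemma red_lt (hZ : ∀ a, Z N (E a)) {F : Set (V n)} (a b : Fin n ⊕ Fin n) (hab : a ≠ b)
    (ha : ∀ x ∈ F, om x (E a) = 0) (hb : ∀ x ∈ F, om x (E b.swap) = 0)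
    (x : V n) (h : b = a.swap ∨ x a.swap = 0) (hxb : x b ≠ 0)
    (hle : (x b).natAbs ≤ (x a).natAbs) :
    ∃ g ∈ K N F, nm (act g x) < nm x := by
  have : ∃ k : ℤ, (x a + k * x b).natAbs < (x a).natAbs := by
    rcases le_or_gt 0 (x a * x b) with hp | hp
    · refine ⟨-1, ?_⟩
      rcases mul_nonneg_iff.1 hp with hp | hp <;> omega
    · refine ⟨1, ?_⟩
      rcases mul_neg_iff.1 hp with hp | hp <;> omega
  obtain ⟨k, hk⟩ := this
  obtain ⟨g, hg, e⟩ := red N hZ a b hab ha hb x h k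
  exact ⟨g, hg, by rw [e]; exact nm_lt _ _ _ hk⟩

/-- Index of a basis vector. -/
def idx : Fin n ⊕ Fin n → Fin n := Sum.elim id id

lemma idx_swap (a : Fin n ⊕ Fin n) : idx a.swap = idx a := by
  rcases a with a | a <;> rfl

/-- The basis vectors with index in `s`. -/
def F (s : Finset (Fin n)) : Set (V n) := {x | ∃ a, idx a ∈ s ∧ x = E a}

lemma F_E {s : Finset (Fin n)} {a : Fin n ⊕ Fin n} (ha : idx a ∉ s) :
    ∀ x ∈ F s, om x (E a) = 0 := by
  rintro x ⟨b, hb, rfl⟩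
  apply om_EE_ne
  rintro rfl
  rw [idx_swap] at ha
  exact ha hb

lemma red_pair (hZ : ∀ a, Z N (E a)) (s : Finset (Fin n)) (x : V n) (a b : Fin n ⊕ Fin n) (hab : a ≠ b)
    (ha : idx a ∉ s) (hb : idx b ∉ s) (hxa : x a ≠ 0) (hxb : x b ≠ 0)
    (h : b = a.swap ∨ (x a.swap = 0 ∧ x b.swap = 0)) :
    ∃ g ∈ K N (F s), nm (act g x) < nm x := by
  rcases le_total (x b).natAbs (x a).natAbs with hle | hle
  · exact red_lt N hZ a b hab (F_E ha) (F_E (by rwa [idx_swap])) x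
      (h.imp id And.left) hxb hle
  · exact red_lt N hZ b a hab.symm (F_E hb) (F_E (by rwa [idx_swap])) x
      (h.imp (fun h => by rw [h, Sum.swap_swap]) And.right) hxa hle

lemma two_step (hZ : ∀ a, Z N (E a)) (s : Finset (Fin n)) (v y w : V n) (hv : Z N v)
    (h1 : om v y = 1) (h2 : om y w = 1) (fv : ∀ x ∈ F s, om x v = 0)
    (fy : ∀ x ∈ F s, om x y = 0) (fw : ∀ x ∈ F s, om x w = 0) :
    ∃ g ∈ K N (F s), act g v = w := by
  have hy : Z N y := hv.next N (Or.inl h1)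
  have z1 : Z N (y - v) := hv.next N (Or.inl (by rw [om_sub_right, om_self, h1]; rfl))
  have z2 : Z N (w - y) := hy.next N (Or.inl (by rw [om_sub_right, om_self, h2]; rfl))
  refine ⟨T 1 (w - y) * T 1 (y - v), mul_mem (T_mem_K N z2 ?_ _) (T_mem_K N z1 ?_ _), ?_⟩
  · intro x hx; rw [om_sub_right, fy x hx, fw x hx]; rfl
  · intro x hx; rw [om_sub_right, fy x hx, fv x hx]; rfl
  · rw [act_mul, T_move _ _ h1, T_move _ _ h2]

lemma final_move (hZ : ∀ a, Z N (E a)) (s : Finset (Fin n)) (a j : Fin n ⊕ Fin n) (ha : idx a ∉ s) (hj : idx j ∉ s)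
    (p : ℤ) (hp : p = 1 ∨ p = -1) : ∃ g ∈ K N (F s), act g (p • E a) = E j := by
  have zv : Z N (p • E a) := by
    rcases hp with rfl | rfl
    · simpa using hZ a
    · simpa using (hZ a).neg N
  have ha' : idx a.swap ∉ s := by rwa [idx_swap]
  have hj' : idx j.swap ∉ s := by rwa [idx_swap]
  have hpp : p * p = 1 := by rcases hp with rfl | rfl <;> rfl
  have lin : ∀ (c d : ℤ) (u w : V n), (∀ x ∈ F s, om x u = 0) → (∀ x ∈ F s, om x w = 0) →
      ∀ x ∈ F s, om x (c • u + d • w) = 0 := by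
    intro c d u w hu hw x hx
    rw [om_add_right, om_smul_right, om_smul_right, hu x hx, hw x hx]; simp
  have fv : ∀ x ∈ F s, om x (p • E a) = 0 := by
    intro x hx
    rw [om_smul_right, F_E ha x hx, mul_zero]
  by_cases haj : a = j
  · subst haj
    rcases hp with rfl | rfl
    · exact ⟨1, one_mem _, by rw [act_one, one_smul]⟩
    · refine two_step N hZ s _ (sg a • E a.swap + 0 • E a) _ zv ?_ ?_ fv
        (lin _ _ _ _ (F_E ha') (F_E ha)) (F_E ha)
      · rw [om_add_right, om_smul_right, om_smul_right, om_smul_left, om_EE, om_smul_left]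
        linear_combination sg_sq a
      · rw [om_add_left, om_smul_left, om_smul_left, om_E, E_same]
        linear_combination sg_sq a
  by_cases haj' : a = j.swap
  · subst haj'
    refine two_step N hZ s _ ((p * sg j) • E j + sg j • E j.swap) _ zv ?_ ?_ fv
        (lin _ _ _ _ (F_E hj) (F_E hj')) (F_E hj)
    · rw [om_add_right, om_smul_right, om_smul_right, om_smul_left, om_E, E_same, om_smul_left,
        om_self]
      linear_combination p * p * sg_sq j + hpp
    · rw [om_add_left, om_smul_left, om_smul_left, om_E _ j, om_E _ j, E_same, E_ne (swap_ne j)]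
      linear_combination sg_sq j
  · have n1 : j.swap ≠ a.swap := fun h => haj (by simpa using (congrArg Sum.swap h).symm)
    refine two_step N hZ s _ ((-(p * sg a)) • E a.swap + sg j • E j.swap) _ zv ?_ ?_ fv
        (lin _ _ _ _ (F_E ha') (F_E hj')) (F_E hj)
    · rw [om_add_right, om_smul_right, om_smul_right, om_smul_left, om_EE, om_smul_left,
        om_EE_ne n1]
      linear_combination p * p * sg_sq a + hpp
    · rw [om_add_left, om_smul_left, om_smul_left, om_E _ j, om_E _ j, E_same,
        E_ne n1]
      linear_combination sg_sq j

lemma transit (hZ : ∀ a, Z N (E a)) (s : Finset (Fin n)) (j : Fin n ⊕ Fin n) (hj : idx j ∉ s) :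
    ∀ (m : ℕ) (v : V n), nm v = m → (∀ x ∈ F s, om x v = 0) → (∃ u, om v u = 1) →
    ∃ g ∈ K N (F s), act g v = E j := by
  intro m
  induction m using Nat.strong_induction_on with
  | _ m ih =>
  intro v hm hv hu
  have hred : (∃ g ∈ K N (F s), nm (act g v) < nm v) → ∃ g ∈ K N (F s), act g v = E j := by
    rintro ⟨g, hg, hlt⟩
    obtain ⟨h, hh, e⟩ := ih _ (hm ▸ hlt) (act g v) rfl
      (fun x hx => by rw [← hg.2 x hx, om_act]; exact hv x hx)
      (by obtain ⟨u, hu⟩ := hu; exact ⟨act g u, by rw [om_act]; exact hu⟩)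
    exact ⟨h * g, mul_mem hh hg, by rw [act_mul, e]⟩
  have supp : ∀ a, v a ≠ 0 → idx a ∉ s := by
    intro a ha hs
    have := hv (E a.swap) ⟨a.swap, by rwa [idx_swap], rfl⟩
    rw [om_swap v, om_E, Sum.swap_swap] at this
    rcases sg_cases a.swap with h | h <;> rw [h] at this <;> omega
  have hv0 : ∃ a, v a ≠ 0 := by
    by_contra! h
    have : v = 0 := funext h
    obtain ⟨u, hu⟩ := hu
    rw [this] at hu
    simp [om] at hu
  obtain ⟨a, ha⟩ := hv0
  by_cases h1 : ∃ b, b ≠ a ∧ v b ≠ 0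
  · apply hred
    obtain ⟨b, hba, hb⟩ := h1
    by_cases ha' : v a.swap = 0
    · by_cases hb' : v b.swap = 0
      · exact red_pair N hZ s v a b hba.symm (supp a ha) (supp b hb) ha hb (Or.inr ⟨ha', hb'⟩)
      · exact red_pair N hZ s v b b.swap (swap_ne b).symm (supp b hb) (supp _ hb') hb hb'
          (Or.inl rfl)
    · exact red_pair N hZ s v a a.swap (swap_ne a).symm (supp a ha) (supp _ ha') ha ha'
          (Or.inl rfl)
  · push Not at h1
    have e : v = v a • E a := by
      ext b
      by_cases hb : b = a
      · subst hb; simp [E_same]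
      · simp [E_ne hb, h1 b hb]
    have hp : v a = 1 ∨ v a = -1 := by
      obtain ⟨u, hu⟩ := hu
      rw [e, om_smul_left] at hu
      exact Int.isUnit_iff.1 (IsUnit.of_mul_eq_one _ hu)
    rw [e]
    exact final_move N hZ s a j (supp a ha) hj _ hp

lemma stage2_aux (hZ : ∀ a, Z N (E a)) (g : G n) (s : Finset (Fin n)) :
    ∃ h ∈ N, ∀ x ∈ F s, act (h * g) x = x := by
  induction s using Finset.induction_on with
  | empty => exact ⟨1, N.one_mem, by rintro x ⟨a, ha, _⟩; simp at ha⟩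
  | insert j s hj ih =>
    obtain ⟨h, hh, hf⟩ := ih
    set g1 := h * g with hg1
    have e1 : om (E (Sum.inr j) : V n) (E (Sum.inl j)) = 1 := by
      have := om_EE (Sum.inr j : Fin n ⊕ Fin n)
      simpa [sg] using this
    have perp : ∀ (k : G n) (a : Fin n ⊕ Fin n), idx a ∉ s → (∀ x ∈ F s, act k x = x) →
        ∀ x ∈ F s, om x (act k (E a)) = 0 := by
      intro k a ha hk x hx
      rw [← hk x hx, om_act]
      exact F_E ha x hx
    obtain ⟨k, hk, hk2⟩ := transit N hZ s (Sum.inr j) hj _ (act g1 (E (Sum.inr j))) rfl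
      (perp g1 (Sum.inr j) hj hf) ⟨act g1 (E (Sum.inl j)), by rw [om_act, e1]⟩
    have hf2 : ∀ x ∈ F s, act (k * g1) x = x := by
      intro x hx
      rw [act_mul, hf x hx, hk.2 x hx]
    rw [← act_mul] at hk2
    set g2 := k * g1 with hg2
    set b := act g2 (E (Sum.inl j)) with hb
    have hab : om (E (Sum.inr j)) b = 1 := by
      rw [← hk2, om_act, e1]
    obtain ⟨m1, m2⟩ := moveA (E (Sum.inr j)) b (E (Sum.inl j)) hab e1
    set c := om b (E (Sum.inl j)) - 1 with hc
    have hbc : ∀ x ∈ F s, om x b = 0 := perp g2 (Sum.inl j) hj hf2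
    have q : T 1 (E (Sum.inl j) - (b - c • E (Sum.inr j))) * T c (E (Sum.inr j)) ∈ K N (F s) := by
      refine mul_mem (T_mem_K N ((hZ (Sum.inl j)).next N (Or.inl ?_)) ?_ _)
        (T_mem_K N (hZ _) (F_E hj) _)
      · rw [om_sub_right, om_sub_right, om_smul_right, om_self, om_swap b,
          om_swap (E (Sum.inr j)), e1, hc]
        ring
      · intro x hx
        rw [om_sub_right, om_sub_right, om_smul_right, hbc x hx, F_E hj x hx, F_E hj x hx]
        simp
    generalize T 1 (E (Sum.inl j) - (b - c • E (Sum.inr j))) * T c (E (Sum.inr j)) = r at m1 m2 q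
    refine ⟨r * (k * h), N.mul_mem q.1 (N.mul_mem hk.1 hh), ?_⟩
    have eq : r * (k * h) * g = r * g2 := by rw [hg2, hg1]; group
    rw [eq]
    rintro x ⟨a, ha, rfl⟩
    rw [act_mul]
    rcases Finset.mem_insert.1 ha with ha | ha
    · rcases a with a | a
      · have : a = j := ha
        subst this
        exact m1
      · have : a = j := ha
        subst this
        rw [hk2, m2]
    · rw [hf2 _ ⟨a, ha, rfl⟩, q.2 _ ⟨a, ha, rfl⟩]

lemma stage2 (hZ : ∀ a, Z N (E a)) : N = ⊤ := by
  rw [Subgroup.eq_top_iff']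
  intro g
  obtain ⟨h, hh, H⟩ := stage2_aux N hZ g Finset.univ
  have : h * g = 1 := ext_E fun a => by
    rw [H _ ⟨a, Finset.mem_univ _, rfl⟩, act_one]
  rw [eq_inv_of_mul_eq_one_right this]
  exact N.inv_mem hh

end stage2

lemma act_S (e f x : V n) (h : om e f = 1) :
    act (T 1 e * T 1 f) x = x + om x f • f + (om x e - om x f) • e := by
  have h' := om_swap e f
  simp only [act_mul, act_T, om_add_left, om_smul_left, h', h]
  module

lemma act_S2 (e f x : V n) (h : om e f = 1) :
    act ((T 1 e * T 1 f) ^ 2) x = x + (om x f + om x e) • f + (om x e - 2 * om x f) • e := by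
  have h' := om_swap e f
  simp only [pow_two, act_mul (T 1 e * T 1 f), act_S _ _ _ h, om_add_left, om_smul_left, om_self,
    h', h]
  module

lemma act_S3 (e f x : V n) (h : om e f = 1) :
    act ((T 1 e * T 1 f) ^ 3) x = x + (2 * om x e) • f + (- 2 * om x f) • e := by
  have h' := om_swap e f
  rw [pow_succ, act_mul]
  simp only [act_S2 _ _ _ h, act_S _ _ _ h, om_add_left, om_smul_left, om_self, h', h]
  module

lemma order_S (e f : V n) (h : om e f = 1) : orderOf (T 1 e * T 1 f) = 6 := by
  have h' := om_swap e f
  apply orderOf_eq_of_pow_and_pow_div_prime (by norm_num)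
  · apply ext_act
    intro x
    rw [show 6 = 3 + 3 from rfl, pow_add, act_mul, act_one]
    simp only [act_S3 _ _ _ h, om_add_left, om_smul_left, om_self, h', h]
    module
  · intro p hp hd
    have : p ∈ Nat.primeFactors 6 := by simp [hp, hd]
    have h6 : Nat.primeFactors 6 = {2, 3} := by
      rw [show 6 = 2 * 3 from rfl, Nat.primeFactors_mul (by norm_num) (by norm_num),
        Nat.Prime.primeFactors Nat.prime_two, Nat.Prime.primeFactors Nat.prime_three]
      rfl
    rw [h6] at this
    simp only [Finset.mem_insert, Finset.mem_singleton] at this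
    rcases this with rfl | rfl
    · intro hc
      have := congrArg (fun g => om (act g e) f) hc
      simp only [show 6 / 2 = 3 from rfl, act_S3 _ _ _ h, act_one, om_add_left, om_smul_left,
        om_self, h] at this
      omega
    · intro hc
      have := congrArg (fun g => om (act g e) f) hc
      simp only [show 6 / 3 = 2 from rfl, act_S2 _ _ _ h, act_one, om_add_left, om_smul_left,
        om_self, h] at this
      omega

lemma om_rl (i j : Fin n) :
    om (E (Sum.inr i) : V n) (E (Sum.inl j)) = if i = j then 1 else 0 := by
  rw [om_E]
  by_cases h : i = j
  · subst h; simp [sg, E]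
  · simp [sg, E, h, Ne.symm h]

lemma om_rr (i j : Fin n) : om (E (Sum.inr i) : V n) (E (Sum.inr j)) = 0 := by
  rw [om_E]
  simp [E]

end SpGen

/-- For every `n ≥ 3`, the symplectic group `Sp(2n, ℤ)` is generated by the
conjugates of a single element of order exactly `6`. -/
theorem symplectic_generated_by_conjugates_of_order_six
    (n : ℕ) (hn : 3 ≤ n) :
    ∃ S : Matrix.symplecticGroup (Fin n) ℤ,
      orderOf S = 6 ∧ Subgroup.normalClosure {S} = ⊤ := by
  let i0 : Fin n := ⟨0, by omega⟩
  let i1 : Fin n := ⟨1, by omega⟩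
  let i2 : Fin n := ⟨2, by omega⟩
  have h00 : SpGen.om (SpGen.E (Sum.inr i0)) (SpGen.E (Sum.inl i0)) = 1 := by
    simp [SpGen.om_rl]
  refine ⟨SpGen.T 1 (SpGen.E (Sum.inr i0)) * SpGen.T 1 (SpGen.E (Sum.inl i0)),
    SpGen.order_S _ _ h00, ?_⟩
  apply SpGen.stage2
  intro a
  apply SpGen.Z_E _ (Sum.inr i0) a
  refine SpGen.stage1 _ _ (SpGen.E (Sum.inr i1)) (SpGen.E (Sum.inr i2)) (SpGen.E (Sum.inl i0))
    (SpGen.E (Sum.inl i1)) (SpGen.E (Sum.inl i2)) (SpGen.om_rr _ _) (SpGen.om_rr _ _)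
    (SpGen.om_rr _ _) h00 ?_ ?_ ?_ ?_ ?_ ?_ ?_ ?_
    (Subgroup.subset_normalClosure (Set.mem_singleton _))
  all_goals simp [SpGen.om_rl, i0, i1, i2]
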